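/- arXiv:2205.05347 — 3 statements merged into one kernel-verified Lean document; each statement's English description precedes it below -/
import Mathlib

section
/- For every integer n with |n| ≥ 2, the Laurent polynomial Q(n) is nonzero, the minimum of its support is n − 1, and the maximum of its support is n + 1; that is, e'(Q(n)) = n − 1 and E'(Q(n)) = n + 1. -/
open LaurentPolynomial

/-- Closed form of the sequence. -/
noncomputable def closedQ (n : ℤ) : LaurentPolynomial ℤ :=
  T n * (C (Int.fib (n + 1)) * T (-1) - C (Int.fib (n - 1)) * T 1)

theorem T_two_eq : (T 2 : LaurentPolynomial ℤ) = T 1 * T 1 := by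
  rw [← T_add]; norm_num

theorem closedQ_rec (n : ℤ) :
    closedQ (n + 2) = T 1 * closedQ (n + 1) + T 2 * closedQ n := by
  have h1 : Int.fib (n + 2 + 1) = Int.fib (n + 1) + Int.fib (n + 1 + 1) := by
    rw [← Int.fib_add_two]; congr 1; ring
  have h2 : Int.fib (n + 2 - 1) = Int.fib (n - 1) + Int.fib (n + 1 - 1) := by
    have := Int.fib_add_two (n - 1)
    rw [show n - 1 + 2 = n + 2 - 1 by ring, show n - 1 + 1 = n + 1 - 1 by ring] at this
    exact this
  simp only [closedQ, h1, h2, T_add n, T_two_eq, map_add]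
  ring

theorem closedQ_coeff (n m : ℤ) : (closedQ n).coeff m =
    (if m = n - 1 then Int.fib (n + 1) else 0) - (if m = n + 1 then Int.fib (n - 1) else 0) := by
  have : closedQ n = .single (n - 1) (Int.fib (n + 1)) - .single (n + 1) (Int.fib (n - 1)) := by
    rw [single_eq_C_mul_T, single_eq_C_mul_T, closedQ, T_add, T_sub]
    ring
  rw [this]
  simp only [AddMonoidAlgebra.coeff_sub, Finsupp.sub_apply, AddMonoidAlgebra.coeff_single,
    Finsupp.single_apply, eq_comm (b := m)]

theorem closedQ_support (n : ℤ) (hn : 2 ≤ |n|) :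
    (closedQ n).coeff.support = {n - 1, n + 1} := by
  have h1 : Int.fib (n + 1) ≠ 0 := by
    rw [Ne, Int.fib_eq_zero]; rintro h
    rw [show n = -1 by omega] at hn; norm_num at hn
  have h2 : Int.fib (n - 1) ≠ 0 := by
    rw [Ne, Int.fib_eq_zero]; rintro h
    rw [show n = 1 by omega] at hn; norm_num at hn
  ext m
  rw [Finsupp.mem_support_iff, closedQ_coeff]
  simp only [Finset.mem_insert, Finset.mem_singleton]
  by_cases a : m = n - 1
  · have : m ≠ n + 1 := by omega
    simp [a, h1]
    omega
  · by_cases b : m = n + 1 <;> simp [a, b, h2]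
    omega

/-- For every integer `n` with `|n| ≥ 2`, the Laurent polynomial `Q n` is nonzero, the minimum
of its support is `n - 1` and the maximum of its support is `n + 1`.  Here `Q` is determined by
`Q 0 = v⁻¹ - v`, `Q 1 = 1` and the recurrence `Q (n+2) = v * Q (n+1) + v² * Q n`. -/
theorem stmt_7 (Q : ℤ → LaurentPolynomial ℤ) (hQ0 : Q 0 = T (-1) - T 1) (hQ1 : Q 1 = 1)
    (hQrec : ∀ n : ℤ, Q (n + 2) = T 1 * Q (n + 1) + T 2 * Q n) :
    ∀ n : ℤ, 2 ≤ |n| →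
      Q n ≠ 0 ∧ (Q n).coeff.support.min = ((n - 1 : ℤ) : WithTop ℤ)
        ∧ (Q n).coeff.support.max = ((n + 1 : ℤ) : WithBot ℤ) := by
  have key : ∀ n : ℤ, Q n = closedQ n ∧ Q (n + 1) = closedQ (n + 1) := by
    intro n
    induction n using Int.induction_on with
    | zero =>
      refine ⟨?_, ?_⟩
      · rw [hQ0]; simp [closedQ]
      · rw [zero_add, hQ1]; rw [closedQ, show (1 : ℤ) + 1 = 2 by rfl, sub_self, Int.fib_two, Int.fib_zero, map_zero,
          map_one, one_mul, zero_mul, sub_zero, ← T_add, add_neg_cancel, T_zero]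
    | succ i ih =>
      refine ⟨ih.2, ?_⟩
      rw [show (i : ℤ) + 1 + 1 = i + 2 by ring, hQrec, closedQ_rec, ih.1, ih.2]
    | pred i ih =>
      have e : -(i : ℤ) - 1 + 1 = -i := by ring
      have e2 : -(i : ℤ) - 1 + 2 = -i + 1 := by ring
      have hq := hQrec (-(i : ℤ) - 1)
      have hc := closedQ_rec (-(i : ℤ) - 1)
      rw [e, e2] at hq hc
      rw [e]
      refine ⟨?_, ih.1⟩
      rw [ih.1, ih.2, hc] at hq
      exact ((isUnit_T (R := ℤ) 2).mul_left_cancel (add_left_cancel hq)).symm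
  intro n hn
  have hs := closedQ_support n hn
  rw [(key n).1]
  refine ⟨?_, ?_, ?_⟩
  · intro h
    rw [h] at hs
    have : n - 1 ∈ ({n - 1, n + 1} : Finset ℤ) := by simp
    rw [← hs] at this
    simp at this
  · rw [hs, Finset.min_insert, Finset.min_singleton]
    exact min_eq_left (WithTop.coe_le_coe.2 (by omega))
  · rw [hs, Finset.max_insert, Finset.max_singleton]
    exact max_eq_right (WithBot.coe_le_coe.2 (by omega))
end

section
/- Let p and q be odd integers, both different from 1 and −1, and set R = v·Q(p+q) + v²·Q(p)·Q(q) ∈ ℤ[v^{±1}]. Then R ≠ 0, the maximum of the support of R is p + q + 4 with coefficient F(p−1)·F(q−1), and the minimum of the support of R is p + q with coefficient F(p+q+1) + F(p+1)·F(q+1); that is, e'(R) = p + q and E'(R) = p + q + 4. (R is the specialization z = 1 of the Homflypt polynomial of the pretzel knot P(p,q,−2).) -/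
open LaurentPolynomial

/-- Any two-sided sequence satisfying the Fibonacci recurrence is determined by its values. -/
theorem fib_general {A : Type*} [CommRing A] (F : ℤ → ℤ) (hF0 : F 0 = 0) (hF1 : F 1 = 1)
    (hFrec : ∀ n : ℤ, F (n + 2) = F (n + 1) + F n)
    (G : ℤ → A) (hG : ∀ n : ℤ, G (n + 2) = G (n + 1) + G n) (n : ℤ) :
    G n = (F n : A) * G 1 + ((F (n + 1) - F n : ℤ) : A) * G 0 ∧
    G (n + 1) = (F (n + 1) : A) * G 1 + ((F n : ℤ) : A) * G 0 := by
  induction n using Int.induction_on with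
  | zero => simp [hF0, hF1]
  | succ k ih =>
    obtain ⟨h1, h2⟩ := ih
    have e : (k : ℤ) + 1 + 1 = k + 2 := by ring
    rw [e, hG, hFrec, h2, h1]
    push_cast
    constructor <;> ring
  | pred k ih =>
    obtain ⟨h1, h2⟩ := ih
    have a := hFrec (-(k : ℤ) - 1)
    have b := hG (-(k : ℤ) - 1)
    have e : -(k : ℤ) - 1 + 2 = -k + 1 := by ring
    have e' : -(k : ℤ) - 1 + 1 = -k := by ring
    rw [e, e'] at a b
    rw [e']
    have c : F (-(k : ℤ) - 1) = F (-k + 1) - F (-k) := by linarith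
    have d : G (-(k : ℤ) - 1) = G (-k + 1) - G (-k) := by rw [b]; ring
    rw [d, c, h2, h1]
    push_cast
    constructor <;> ring

theorem fib_pos (F : ℤ → ℤ) (hF0 : F 0 = 0) (hF1 : F 1 = 1)
    (hFrec : ∀ n : ℤ, F (n + 2) = F (n + 1) + F n) (k : ℕ) :
    1 ≤ F (2 * k + 3) ∧ F (2 * k + 3) < F (2 * k + 3 + 1) := by
  induction k with
  | zero =>
    have h2 := hFrec 0
    have h3 := hFrec 1
    have h4 := hFrec 2
    norm_num at *
    omega
  | succ k ih =>
    have h1 := hFrec (2 * k + 3)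
    have h2 := hFrec (2 * k + 3 + 1)
    have e1 : (2 * (k : ℤ) + 3 + 1 + 2) = 2 * ((k + 1 : ℕ) : ℤ) + 3 + 1 := by push_cast; ring
    have e2 : (2 * (k : ℤ) + 3 + 1 + 1) = 2 * ((k + 1 : ℕ) : ℤ) + 3 := by push_cast; ring
    have e3 : (2 * (k : ℤ) + 3 + 2) = 2 * ((k + 1 : ℕ) : ℤ) + 3 := by push_cast; ring
    rw [e1, e2] at h2
    rw [e3] at h1
    omega

theorem fib_neg (F : ℤ → ℤ) (hF0 : F 0 = 0) (hF1 : F 1 = 1)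
    (hFrec : ∀ n : ℤ, F (n + 2) = F (n + 1) + F n) (k : ℕ) :
    1 ≤ F (-2 * k - 3) ∧ F (-2 * k - 3 + 1) ≤ -1 ∧
      F (-2 * k - 3) ≤ -2 * F (-2 * k - 3 + 1) := by
  induction k with
  | zero =>
    have h2 := hFrec (-1)
    have h3 := hFrec (-2)
    have h4 := hFrec (-3)
    norm_num at *
    omega
  | succ k ih =>
    have h1 := hFrec (-2 * ((k + 1 : ℕ) : ℤ) - 3)
    have h2 := hFrec (-2 * ((k + 1 : ℕ) : ℤ) - 3 + 1)
    have e1 : -2 * ((k + 1 : ℕ) : ℤ) - 3 + 1 + 2 = -2 * (k : ℤ) - 3 + 1 := by push_cast; ring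
    have e2 : -2 * ((k + 1 : ℕ) : ℤ) - 3 + 1 + 1 = -2 * (k : ℤ) - 3 := by push_cast; ring
    have e3 : -2 * ((k + 1 : ℕ) : ℤ) - 3 + 2 = -2 * (k : ℤ) - 3 := by push_cast; ring
    rw [e1, e2] at h2
    rw [e3] at h1
    omega

theorem fib_cases (F : ℤ → ℤ) (hF0 : F 0 = 0) (hF1 : F 1 = 1)
    (hFrec : ∀ n : ℤ, F (n + 2) = F (n + 1) + F n) (p : ℤ) (hp : Odd p)
    (hp1 : p ≠ 1) (hp1' : p ≠ -1) :
    (1 ≤ F p ∧ F p < F (p + 1)) ∨ (1 ≤ F p ∧ F (p + 1) ≤ -1 ∧ F p ≤ -2 * F (p + 1)) := by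
  obtain ⟨m, rfl⟩ := hp
  rcases le_or_gt 1 m with h | h
  · left
    obtain ⟨k, rfl⟩ := Int.le.dest h
    have := fib_pos F hF0 hF1 hFrec k
    have e : 2 * (1 + (k : ℤ)) + 1 = 2 * k + 3 := by ring
    rw [e]; exact this
  · right
    have h' : m ≤ -2 := by omega
    obtain ⟨k, hk⟩ := Int.le.dest h'
    have := fib_neg F hF0 hF1 hFrec k
    have e : 2 * m + 1 = -2 * (k : ℤ) - 3 := by omega
    rw [e]; exact this

/-- Let `p, q` be odd integers different from `1` and `-1`, and set
`R = v * Q (p+q) + v² * Q p * Q q`.  Then `R ≠ 0`, the maximum of the support of `R` is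
`p + q + 4` with coefficient `F (p-1) * F (q-1)`, and the minimum of the support of `R` is
`p + q` with coefficient `F (p+q+1) + F (p+1) * F (q+1)`.  Here `F` is the two-sided
Fibonacci sequence and `Q` is as in the context. -/
theorem stmt_8 (F : ℤ → ℤ) (hF0 : F 0 = 0) (hF1 : F 1 = 1)
    (hFrec : ∀ n : ℤ, F (n + 2) = F (n + 1) + F n)
    (Q : ℤ → LaurentPolynomial ℤ) (hQ0 : Q 0 = T (-1) - T 1) (hQ1 : Q 1 = 1)
    (hQrec : ∀ n : ℤ, Q (n + 2) = T 1 * Q (n + 1) + T 2 * Q n)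
    (p q : ℤ) (hp : Odd p) (hq : Odd q) (hp1 : p ≠ 1) (hp1' : p ≠ -1)
    (hq1 : q ≠ 1) (hq1' : q ≠ -1)
    (R : LaurentPolynomial ℤ) (hR : R = T 1 * Q (p + q) + T 2 * Q p * Q q) :
    R ≠ 0 ∧ R.coeff.support.max = ((p + q + 4 : ℤ) : WithBot ℤ)
      ∧ R.coeff (p + q + 4) = F (p - 1) * F (q - 1)
      ∧ R.coeff.support.min = ((p + q : ℤ) : WithTop ℤ)
      ∧ R.coeff (p + q) = F (p + q + 1) + F (p + 1) * F (q + 1) := by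
  -- closed form for Q
  have hQ : ∀ n : ℤ, Q n = T (n - 1) * (C (F (n + 1)) - C (F (n - 1)) * T 2) := by
    intro n
    have hG := (fib_general F hF0 hF1 hFrec (fun n => T (1 - n) * Q n) (by
      intro n
      simp only [hQrec, mul_add, ← mul_assoc, ← T_add]
      congr 3 <;> ring_nf) n).1
    simp only [hQ0, hQ1] at hG
    have e := hFrec (n - 1)
    have e1 : n - 1 + 2 = n + 1 := by ring
    have e2 : n - 1 + 1 = n := by ring
    rw [e1, e2] at e
    have e3 : Q n = T (n - 1) * (T (1 - n) * Q n) := by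
      rw [← mul_assoc, ← T_add]; simp
    rw [e3, hG]
    congr 1
    have e4 : F (n - 1) = F (n + 1) - F n := by linarith
    rw [e4]
    simp only [sub_zero, sub_self, T_zero, mul_sub, ← T_add]
    norm_num
    ring
  have addF : F (p + q + 1) = F (p + 1) * F (q + 1) + F p * F q := by
    have h := (fib_general F hF0 hF1 hFrec (fun n => F (n + q)) (by
      intro n
      have := hFrec (n + q)
      rw [show n + 2 + q = n + q + 2 by ring, show n + 1 + q = n + q + 1 by ring]
      exact this) p).2
    simp only [Int.cast_id, zero_add] at h
    rw [show p + q + 1 = p + 1 + q by ring, h, add_comm 1 q]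
  have predF : ∀ n, F (n - 1) = F (n + 1) - F n := by
    intro n
    have := hFrec (n - 1)
    rw [show n - 1 + 2 = n + 1 by ring, show n - 1 + 1 = n by ring] at this
    linarith
  have cp := fib_cases F hF0 hF1 hFrec p hp hp1 hp1'
  have cq := fib_cases F hF0 hF1 hFrec q hq hq1 hq1'
  have htop : F (p - 1) * F (q - 1) ≠ 0 := by
    rw [predF, predF]
    apply mul_ne_zero <;> omega
  have hbot : F (p + q + 1) + F (p + 1) * F (q + 1) ≠ 0 := by
    rw [addF]
    generalize F p = a at *
    generalize F q = b at *
    generalize F (p + 1) = c at *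
    generalize F (q + 1) = d at *
    rcases cp with ⟨h1, h2⟩ | ⟨h1, h2, h3⟩ <;> rcases cq with ⟨h4, h5⟩ | ⟨h4, h5, h6⟩
    · have : 0 < c * d := mul_pos (by omega) (by omega)
      have : 0 < a * b := mul_pos (by omega) (by omega)
      omega
    · have : a * b ≤ a * (-2 * d) := mul_le_mul_of_nonneg_left h6 (by omega)
      have : a * (-2 * d) < c * (-2 * d) := mul_lt_mul_of_pos_right h2 (by omega)
      have : c * (-2 * d) = -2 * (c * d) := by ring
      omega
    · have : a * b ≤ (-2 * c) * b := mul_le_mul_of_nonneg_right h3 (by omega)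
      have : (-2 * c) * b < (-2 * c) * d := mul_lt_mul_of_pos_left h5 (by omega)
      have : (-2 * c) * d = -2 * (c * d) := by ring
      omega
    · have : 0 < c * d := mul_pos_of_neg_of_neg (by omega) (by omega)
      have : 0 < a * b := mul_pos (by omega) (by omega)
      omega
  obtain ⟨M, hM⟩ : ∃ M : ℤ, R = C (F (p + q + 1) + F (p + 1) * F (q + 1)) * T (p + q)
      + C M * T (p + q + 2) + C (F (p - 1) * F (q - 1)) * T (p + q + 4) := by
    refine ⟨-F (p + q - 1) - F (p + 1) * F (q - 1) - F (p - 1) * F (q + 1), ?_⟩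
    rw [hR, hQ, hQ, hQ]
    have t1 : (T (p + q - 1) : ℤ[T;T⁻¹]) * T 1 = T (p + q) := by rw [← T_add]; ring_nf
    have t2 : (T 2 : ℤ[T;T⁻¹]) * T (p - 1) * T (q - 1) = T (p + q) := by
      rw [← T_add, ← T_add]; ring_nf
    have t3 : (T (p + q + 2) : ℤ[T;T⁻¹]) = T (p + q) * T 2 := by rw [← T_add]
    have t4 : (T (p + q + 4) : ℤ[T;T⁻¹]) = T (p + q) * T 2 * T 2 := by
      rw [← T_add, ← T_add]; ring_nf
    rw [t3, t4]
    simp only [map_add, map_sub, map_neg, map_mul]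
    linear_combination (C (F (p + q + 1)) - C (F (p + q - 1)) * T 2) * t1 +
      (C (F (p + 1)) - C (F (p - 1)) * T 2) * (C (F (q + 1)) - C (F (q - 1)) * T 2) * t2
  have hc : ∀ n, R.coeff n = (if p + q = n then F (p + q + 1) + F (p + 1) * F (q + 1) else 0)
      + (if p + q + 2 = n then M else 0)
      + (if p + q + 4 = n then F (p - 1) * F (q - 1) else 0) := by
    intro n
    rw [hM]
    simp only [← single_eq_C_mul_T]
    simp only [AddMonoidAlgebra.coeff_add, AddMonoidAlgebra.coeff_single, Finsupp.add_apply,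
      Finsupp.single_apply]
  have c4 : R.coeff (p + q + 4) = F (p - 1) * F (q - 1) := by
    rw [hc, if_neg (by omega), if_neg (by omega), if_pos rfl]; ring
  have c0 : R.coeff (p + q) = F (p + q + 1) + F (p + 1) * F (q + 1) := by
    rw [hc, if_pos rfl, if_neg (by omega), if_neg (by omega)]; ring
  have hs : ∀ n ∈ R.coeff.support, p + q ≤ n ∧ n ≤ p + q + 4 := by
    intro n hn
    rw [Finsupp.mem_support_iff, hc] at hn
    by_contra hcon
    apply hn
    rw [if_neg (by omega), if_neg (by omega), if_neg (by omega)]; rfl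
  have m4 : p + q + 4 ∈ R.coeff.support := by
    rw [Finsupp.mem_support_iff, c4]; exact htop
  have m0 : p + q ∈ R.coeff.support := by
    rw [Finsupp.mem_support_iff, c0]; exact hbot
  refine ⟨?_, ?_, c4, ?_, c0⟩
  · rintro rfl
    simp at m0
  · apply le_antisymm
    · exact Finset.max_le fun n hn => WithBot.coe_le_coe.2 (hs n hn).2
    · exact Finset.le_max m4
  · apply le_antisymm
    · exact Finset.min_le m0
    · exact Finset.le_min fun n hn => WithTop.coe_le_coe.2 (hs n hn).1
end

section
/- Let p and q be odd integers, both different from 1 and −1, and let r ≥ 2 be an integer. Set A = (v + v³ + ⋯ + v^{2r−1})·Q(p+q) and B = v^{2r}·Q(p)·Q(q) in ℤ[v^{±1}]. Then A + B ≠ 0, the minimum of the support of A + B is p + q, and the maximum of the support of A + B is p + q + 2r + 2; that is, e'(A+B) = p + q and E'(A+B) = p + q + 2r + 2. (A + B is the specialization z = 1 of the Homflypt polynomial of the pretzel knot P(p,q,−2r), so in particular E' − e' + 2 = 2(r+2).) -/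
open LaurentPolynomial

/-- The monomial `a v^n`. -/
noncomputable def vMon (n a : ℤ) : LaurentPolynomial ℤ := AddMonoidAlgebra.single n a

lemma mon_coeff (n a k : ℤ) : (vMon n a).coeff k = if n = k then a else 0 := by
  simp only [vMon, AddMonoidAlgebra.coeff_single, Finsupp.single_apply]

lemma mon_mul (m n a b : ℤ) : vMon m a * vMon n b = vMon (m + n) (a * b) := by
  exact AddMonoidAlgebra.single_mul_single ..

lemma T_eq_vMon (n : ℤ) : (T n : LaurentPolynomial ℤ) = vMon n 1 := rfl

lemma Q_closed (Q : ℤ → LaurentPolynomial ℤ) (hQ0 : Q 0 = T (-1) - T 1) (hQ1 : Q 1 = 1)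
    (hQrec : ∀ n : ℤ, Q (n + 2) = T 1 * Q (n + 1) + T 2 * Q n) (n : ℤ) :
    Q n = vMon (n - 1) (Int.fib (n + 1)) - vMon (n + 1) (Int.fib (n - 1)) := by
  have key : ∀ n : ℤ, (vMon (n + 2 - 1) (Int.fib (n + 2 + 1)) - vMon (n + 2 + 1) (Int.fib (n + 2 - 1)))
      = T 1 * (vMon (n + 1 - 1) (Int.fib (n + 1 + 1)) - vMon (n + 1 + 1) (Int.fib (n + 1 - 1)))
        + T 2 * (vMon (n - 1) (Int.fib (n + 1)) - vMon (n + 1) (Int.fib (n - 1))) := by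
    intro n
    have h1 := Int.fib_add_two (n + 1)
    have h2 := Int.fib_add_two (n - 1)
    rw [show n + 1 + 2 = n + 2 + 1 by ring] at h1
    rw [show n - 1 + 2 = n + 2 - 1 by ring, show n - 1 + 1 = n + 1 - 1 by ring] at h2
    rw [h1, h2]
    ext k
    simp only [T_eq_vMon, mul_sub, mon_mul, AddMonoidAlgebra.coeff_add, AddMonoidAlgebra.coeff_sub,
      Finsupp.add_apply, Finsupp.sub_apply, mon_coeff]
    split_ifs <;> omega
  suffices h : ∀ n : ℤ, Q n = vMon (n - 1) (Int.fib (n + 1)) - vMon (n + 1) (Int.fib (n - 1)) ∧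
      Q (n + 1) = vMon (n + 1 - 1) (Int.fib (n + 1 + 1)) - vMon (n + 1 + 1) (Int.fib (n + 1 - 1)) from
    (h n).1
  intro n
  induction n using Int.induction_on with
  | zero =>
    constructor
    · rw [hQ0]; simp [T_eq_vMon]
    · rw [zero_add, hQ1]
      ext k
      simp only [AddMonoidAlgebra.coeff_sub, Finsupp.sub_apply, mon_coeff, ← T_zero, T_apply]
      norm_num
  | succ i ih =>
    refine ⟨ih.2, ?_⟩
    have := key i
    rw [← ih.1, ← ih.2, ← hQrec] at this
    rw [show (i : ℤ) + 1 + 1 = i + 2 by ring, ← this]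
  | pred i ih =>
    have h1 : Q (-(i : ℤ) - 1 + 1) = vMon (-(i : ℤ) - 1 + 1 - 1) (Int.fib (-(i : ℤ) - 1 + 1 + 1)) -
        vMon (-(i : ℤ) - 1 + 1 + 1) (Int.fib (-(i : ℤ) - 1 + 1 - 1)) := by
      rw [show -(i : ℤ) - 1 + 1 = -i by ring]; exact ih.1
    refine ⟨?_, h1⟩
    have h2 := ih.2
    rw [show -(i : ℤ) + 1 = -i - 1 + 2 by ring, key, hQrec, h1] at h2
    exact (isUnit_T 2).mul_left_cancel (add_left_cancel h2)

lemma A_coeff (a b s k : ℤ) (m : ℕ) :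
    (k < s → ((∑ i ∈ Finset.range m, T (2 * (i : ℤ) + 1)) *
      (vMon (s - 1) a - vMon (s + 1) b)).coeff k = 0) ∧
    (k = s → 0 < m → ((∑ i ∈ Finset.range m, T (2 * (i : ℤ) + 1)) *
      (vMon (s - 1) a - vMon (s + 1) b)).coeff k = a) ∧
    (s + 2 * m < k → ((∑ i ∈ Finset.range m, T (2 * (i : ℤ) + 1)) *
      (vMon (s - 1) a - vMon (s + 1) b)).coeff k = 0) := by
  induction m with
  | zero => simp
  | succ m ih =>
    simp only [Finset.sum_range_succ, add_mul, AddMonoidAlgebra.coeff_add, Finsupp.add_apply]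
    simp only [T_eq_vMon (2 * (m : ℤ) + 1), mul_sub _ (vMon (s - 1) a), mon_mul] at ih ⊢
    simp only [AddMonoidAlgebra.coeff_sub, Finsupp.sub_apply, mon_coeff] at ih ⊢
    obtain ⟨i1, i2, i3⟩ := ih
    refine ⟨fun h => ?_, fun h _ => ?_, fun h => ?_⟩
    · rw [i1 h]; push_cast; split_ifs <;> omega
    · rcases Nat.eq_zero_or_pos m with rfl | hm
      · simp [h]; omega
      · rw [i2 h hm]; split_ifs <;> omega
    · rw [i3 (by push_cast at h; omega)]; push_cast at h; split_ifs <;> omega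

/-- Let `p, q` be odd integers different from `1` and `-1`, and let `r ≥ 2` be an integer.
Set `A = (v + v³ + ⋯ + v^(2r-1)) * Q (p+q)` and `B = v^(2r) * Q p * Q q`.  Then `A + B ≠ 0`,
the minimum of the support of `A + B` is `p + q`, and the maximum of the support of `A + B`
is `p + q + 2r + 2`.  Here `Q` is as in the context. -/
theorem stmt_9 (Q : ℤ → LaurentPolynomial ℤ) (hQ0 : Q 0 = T (-1) - T 1) (hQ1 : Q 1 = 1)
    (hQrec : ∀ n : ℤ, Q (n + 2) = T 1 * Q (n + 1) + T 2 * Q n)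
    (p q r : ℤ) (hp : Odd p) (hq : Odd q) (hp1 : p ≠ 1) (hp1' : p ≠ -1)
    (hq1 : q ≠ 1) (hq1' : q ≠ -1) (hr : 2 ≤ r)
    (A B : LaurentPolynomial ℤ)
    (hA : A = (∑ i ∈ Finset.range r.toNat, T (2 * (i : ℤ) + 1)) * Q (p + q))
    (hB : B = T (2 * r) * Q p * Q q) :
    A + B ≠ 0 ∧ (A + B).coeff.support.min = ((p + q : ℤ) : WithTop ℤ)
      ∧ (A + B).coeff.support.max = ((p + q + 2 * r + 2 : ℤ) : WithBot ℤ) := by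
  have hQ := Q_closed Q hQ0 hQ1 hQrec
  have hc : ∀ k, (A + B).coeff k = A.coeff k + B.coeff k := fun k => rfl
  rw [hQ] at hA
  have hAc : ∀ k, _ := fun k => A_coeff (Int.fib (p + q + 1)) (Int.fib (p + q - 1)) (p + q) k r.toNat
  rw [← hA] at hAc
  have hrr : (r.toNat : ℤ) = r := Int.toNat_of_nonneg (by omega)
  rw [hrr] at hAc
  have hBc : ∀ k, B.coeff k =
      (if 2 * r + (p - 1) + (q - 1) = k then Int.fib (p + 1) * Int.fib (q + 1) else 0)
      - (if 2 * r + (p + 1) + (q - 1) = k then Int.fib (p - 1) * Int.fib (q + 1) else 0)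
      - ((if 2 * r + (p - 1) + (q + 1) = k then Int.fib (p + 1) * Int.fib (q - 1) else 0)
      - (if 2 * r + (p + 1) + (q + 1) = k then Int.fib (p - 1) * Int.fib (q - 1) else 0)) := by
    intro k
    rw [hB, hQ p, hQ q]
    simp only [T_eq_vMon, mul_sub, sub_mul, mon_mul, AddMonoidAlgebra.coeff_sub, Finsupp.sub_apply,
      mon_coeff, one_mul]
  have hlow : ∀ k, k < p + q → (A + B).coeff k = 0 := by
    intro k hk
    rw [hc, hBc, (hAc k).1 hk]; split_ifs <;> omega
  have hhigh : ∀ k, p + q + 2 * r + 2 < k → (A + B).coeff k = 0 := by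
    intro k hk
    rw [hc, hBc, (hAc k).2.2 (by omega)]; split_ifs <;> omega
  have hmin : (A + B).coeff (p + q) ≠ 0 := by
    rw [hc, hBc, (hAc _).2.1 rfl (by omega), if_neg (by omega), if_neg (by omega),
      if_neg (by omega), if_neg (by omega)]
    have : Int.fib (p + q + 1) ≠ 0 := by
      rw [Ne, Int.fib_eq_zero]
      obtain ⟨a, rfl⟩ := hp
      obtain ⟨b, rfl⟩ := hq
      omega
    simpa using this
  have hmax : (A + B).coeff (p + q + 2 * r + 2) ≠ 0 := by
    rw [hc, hBc, (hAc _).2.2 (by omega), if_neg (by omega), if_neg (by omega),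
      if_neg (by omega), if_pos (by omega)]
    have h1 : Int.fib (p - 1) ≠ 0 := by rw [Ne, Int.fib_eq_zero]; omega
    have h2 : Int.fib (q - 1) ≠ 0 := by rw [Ne, Int.fib_eq_zero]; omega
    simpa using And.intro h1 h2
  refine ⟨fun h => hmin (by rw [h]; rfl), le_antisymm ?_ ?_, le_antisymm ?_ ?_⟩
  · exact Finset.min_le (Finsupp.mem_support_iff.2 hmin)
  · refine Finset.le_min fun k hk => WithTop.coe_le_coe.2 ?_
    by_contra h
    exact Finsupp.mem_support_iff.1 hk (hlow k (by omega))
  · refine Finset.max_le fun k hk => WithBot.coe_le_coe.2 ?_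
    by_contra h
    exact Finsupp.mem_support_iff.1 hk (hhigh k (by omega))
  · exact Finset.le_max (Finsupp.mem_support_iff.2 hmax)
end
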